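/- Let E_A, E_B be conditional expectations onto algebras N_A, N_B ⊆ B(H_Λ) compatible with a common full-rank state, such that E_A acts trivially (as identity) outside a region A∂ and E_B acts trivially outside B∂, with A∂ ∩ B∂ = ∅. Then E_A ∘ E_B = E_B ∘ E_A = E_{A∪B} (commuting square), and consequently for every state ρ: D(ρ‖E_{A∪B*}(ρ)) ≤ D(ρ‖E_{A*}(ρ)) + D(ρ‖E_{B*}(ρ)). -/

import Mathlib

open Matrix ComplexOrder Kronecker

noncomputable section

def matLog {n : Type*} [Fintype n] [DecidableEq n] (A : Matrix n n ℂ) : Matrix n n ℂ :=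
  cfc Real.log A

/-- Quantum relative entropy `D(ρ‖σ) = Tr[ρ(log ρ − log σ)]`. -/
def relEnt {n : Type*} [Fintype n] [DecidableEq n] (ρ σ : Matrix n n ℂ) : ℝ :=
  ((ρ * (matLog ρ - matLog σ)).trace).re


section helpers
variable {n : Type*} [Fintype n] [DecidableEq n]

lemma hx_diag {A : Matrix n n ℂ} (hA : A.IsHermitian) :
    ∃ (U : Matrix n n ℂ) (p : n → ℝ), Uᴴ * U = 1 ∧ U * Uᴴ = 1 ∧ p = hA.eigenvalues ∧
      A = U * diagonal (fun i => (p i : ℂ)) * Uᴴ ∧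
      ∀ f : ℝ → ℝ, cfc f A = U * diagonal (fun i => (f (p i) : ℂ)) * Uᴴ := by
  refine ⟨hA.eigenvectorUnitary, hA.eigenvalues, ?_, ?_, rfl, ?_, ?_⟩
  · exact Unitary.coe_star_mul_self hA.eigenvectorUnitary
  · exact Unitary.coe_mul_star_self hA.eigenvectorUnitary
  · conv_lhs => rw [hA.spectral_theorem]
    rw [Unitary.conjStarAlgAut_apply]
    rfl
  · intro f
    rw [hA.cfc_eq, Matrix.IsHermitian.cfc, Unitary.conjStarAlgAut_apply]
    rfl

lemma hx_poly {A : Matrix n n ℂ} (hA : A.IsHermitian) (f : ℝ → ℝ) :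
    ∃ p : Polynomial ℝ, cfc f A = Polynomial.aeval A p ∧ ∀ x ∈ spectrum ℝ A, p.eval x = f x := by
  have hfin : (spectrum ℝ A).Finite := Matrix.finite_real_spectrum
  let s := hfin.toFinset
  let p := Lagrange.interpolate s id f
  have hp : ∀ x ∈ spectrum ℝ A, p.eval x = f x := by
    intro x hx
    have := Lagrange.eval_interpolate_at_node (s := s) (v := id) f (i := x)
      (Function.injective_id.injOn) (by simpa [s] using hx)
    exact this
  refine ⟨p, ?_, hp⟩
  rw [← cfc_polynomial p A hA.isSelfAdjoint]
  exact cfc_congr (fun x hx => (hp x hx).symm)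

lemma hx_aeval_mul {A R : Matrix n n ℂ} {l : ℝ} (h : A * R = (l : ℂ) • R) (p : Polynomial ℝ) :
    Polynomial.aeval A p * R = ((p.eval l : ℝ) : ℂ) • R := by
  induction p using Polynomial.induction_on' with
  | add p q hp hq => simp [add_mul, hp, hq, add_smul]
  | monomial k c =>
    have hk : A ^ k * R = ((l : ℂ) ^ k) • R := by
      induction k with
      | zero => simp
      | succ k ih => rw [pow_succ', mul_assoc, ih, mul_smul_comm, h, smul_smul, pow_succ]
    rw [Polynomial.aeval_monomial, mul_assoc, hk, Polynomial.eval_monomial]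
    rw [Algebra.algebraMap_eq_smul_one, smul_mul_assoc, one_mul]
    ext i j
    simp [mul_assoc]

lemma hx_cfc_mul {A R : Matrix n n ℂ} (hA : A.IsHermitian) {l : ℝ} (h : A * R = (l : ℂ) • R)
    (f : ℝ → ℝ) : cfc f A * R = ((f l : ℝ) : ℂ) • R := by
  by_cases hR : R = 0
  · simp [hR]
  obtain ⟨p, hp, hpe⟩ := hx_poly hA f
  have hl : l ∈ spectrum ℝ A := by
    rw [spectrum.mem_iff]
    intro hu
    apply hR
    have h0 : (algebraMap ℝ (Matrix n n ℂ) l - A) * R = 0 := by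
      rw [sub_mul, h, Algebra.algebraMap_eq_smul_one, smul_mul_assoc, one_mul]
      ext i j
      simp
    exact (hu.mul_right_eq_zero).1 h0
  rw [hp, hx_aeval_mul h, hpe l hl]

lemma hx_aeval_comm {A B : Matrix n n ℂ} (h : A * B = B * A) (p : Polynomial ℝ) :
    Polynomial.aeval A p * B = B * Polynomial.aeval A p := by
  induction p using Polynomial.induction_on' with
  | add p q hp hq => simp [add_mul, mul_add, hp, hq]
  | monomial k c =>
    have hk : A ^ k * B = B * A ^ k := (Commute.pow_left h k)
    rw [Polynomial.aeval_monomial, mul_assoc, hk, ← mul_assoc, ← mul_assoc, Algebra.commutes]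

lemma hx_cfc_comm {A B : Matrix n n ℂ} (hA : A.IsHermitian) (f : ℝ → ℝ) (h : A * B = B * A) :
    cfc f A * B = B * cfc f A := by
  obtain ⟨p, hp, hpe⟩ := hx_poly hA f
  rw [hp, hx_aeval_comm h]

lemma hx_split {A : Matrix n n ℂ} (hA : A.IsHermitian) (M : Matrix n n ℂ)
    (h : ∀ t : ℝ, M * cfc (fun x => if x = t then 1 else 0) A = 0) : M = 0 := by
  obtain ⟨U, p, h1, h2, -, h3, h4⟩ := hx_diag hA
  have hMU : M * U = 0 := by
    ext a i
    have := h (p i)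
    rw [h4] at this
    have h5 : M * U * diagonal (fun j => (((if p j = p i then 1 else 0 : ℝ)) : ℂ)) = 0 := by
      have := congrArg (· * U) this
      simpa [mul_assoc, h1] using this
    have := congrFun (congrFun h5 a) i
    rw [mul_diagonal] at this
    simpa using this
  calc M = M * U * Uᴴ := by rw [mul_assoc, h2, mul_one]
    _ = 0 := by rw [hMU, zero_mul]

lemma hx_mul_ind {A : Matrix n n ℂ} (hA : A.IsHermitian) (t : ℝ) :
    A * cfc (fun x => if x = t then 1 else 0) A
      = (t : ℂ) • cfc (fun x => if x = t then 1 else 0) A := by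
  obtain ⟨U, p, h1, h2, -, h3, h4⟩ := hx_diag hA
  rw [h4]
  nth_rw 1 [h3]
  have : U * diagonal (fun i => (p i : ℂ)) * Uᴴ *
      (U * diagonal (fun i => ((if p i = t then 1 else 0 : ℝ) : ℂ)) * Uᴴ)
      = U * (diagonal (fun i => (p i : ℂ)) * (Uᴴ * U) *
        diagonal (fun i => ((if p i = t then 1 else 0 : ℝ) : ℂ))) * Uᴴ := by
    simp only [mul_assoc]
  rw [this, h1, mul_one, diagonal_mul_diagonal, ← smul_mul_assoc, ← mul_smul_comm, ← diagonal_smul]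
  congr 3
  ext i
  simp only [Pi.smul_apply, smul_eq_mul]
  split_ifs with h <;> simp [h]

lemma hx_joint {T F : Matrix n n ℂ} (hT : T.IsHermitian) (hF : F.IsHermitian) (hc : T * F = F * T)
    (M : Matrix n n ℂ)
    (h : ∀ (t s : ℝ) (R : Matrix n n ℂ), T * R = (t : ℂ) • R → F * R = (s : ℂ) • R → M * R = 0) :
    M = 0 := by
  apply hx_split hT
  intro t
  apply hx_split hF
  intro s
  rw [mul_assoc]
  apply h t s
  · rw [← mul_assoc, hx_mul_ind hT, smul_mul_assoc]
  · rw [← mul_assoc, ← hx_cfc_comm hT _ hc, mul_assoc, hx_mul_ind hF, mul_smul_comm]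

end helpers

section dpi
variable {n : Type*} [Fintype n] [DecidableEq n]

lemma hx_trace_pair (U V : Matrix n n ℂ) (d1 d2 : n → ℝ) :
    ((U * diagonal (fun i => (d1 i : ℂ)) * Uᴴ) * (V * diagonal (fun i => (d2 i : ℂ)) * Vᴴ)).trace
      = ((∑ i, ∑ j, Complex.normSq ((Vᴴ * U) i j) * (d1 j * d2 i) : ℝ) : ℂ) := by
  have e : ((U * diagonal (fun i => (d1 i : ℂ)) * Uᴴ) *
      (V * diagonal (fun i => (d2 i : ℂ)) * Vᴴ)).trace
      = (((Vᴴ * U) * diagonal (fun i => (d1 i : ℂ))) * ((Vᴴ * U)ᴴ *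
        diagonal (fun i => (d2 i : ℂ)))).trace := by
    rw [conjTranspose_mul, conjTranspose_conjTranspose]
    rw [← mul_assoc, trace_mul_comm]
    simp only [mul_assoc]
  rw [e, Matrix.trace]
  simp only [diag_apply]
  push_cast
  refine Finset.sum_congr rfl fun i _ => ?_
  rw [Matrix.mul_apply]
  refine Finset.sum_congr rfl fun j _ => ?_
  rw [mul_diagonal, mul_diagonal, conjTranspose_apply]
  generalize (Vᴴ * U) i j = z
  rw [Complex.normSq_eq_conj_mul_self]
  simp only [RCLike.star_def]
  ring

lemma hx_spec_pair {ρ σ : Matrix n n ℂ} (hρ : ρ.PosDef) (hσ : σ.PosDef) :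
    ∃ (w : n → n → ℝ) (p s : n → ℝ), (∀ i j, 0 ≤ w i j) ∧ (∀ j, 0 < p j) ∧ (∀ i, 0 < s i) ∧
      relEnt ρ σ = ∑ i, ∑ j, w i j * (p j * (Real.log (p j) - Real.log (s i))) ∧
      (ρ.trace).re = ∑ i, ∑ j, w i j * p j ∧
      ∀ t : ℝ, 0 ≤ t → ∃ X : Matrix n n ℂ, (t : ℂ) • (X * ρ) + σ * X = ρ ∧
        ((Xᴴ * ρ).trace).re = ∑ i, ∑ j, w i j * (p j * (p j / (t * p j + s i))) := by
  obtain ⟨U, p, hU1, hU2, hp, hρe, hρf⟩ := hx_diag hρ.1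
  obtain ⟨V, s, hV1, hV2, hs, hσe, hσf⟩ := hx_diag hσ.1
  have hp0 : ∀ j, 0 < p j := by intro j; rw [hp]; exact hρ.eigenvalues_pos j
  have hs0 : ∀ j, 0 < s j := by intro j; rw [hs]; exact hσ.eigenvalues_pos j
  refine ⟨fun i j => Complex.normSq ((Vᴴ * U) i j), p, s, fun i j => Complex.normSq_nonneg _,
    hp0, hs0, ?_, ?_, ?_⟩
  · unfold relEnt matLog
    rw [mul_sub, trace_sub, hρf, hσf]
    have e1 : (ρ * (U * diagonal (fun i => (Real.log (p i) : ℂ)) * Uᴴ))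
        = (U * diagonal (fun i => ((p i * Real.log (p i) : ℝ) : ℂ)) * Uᴴ) *
          (V * diagonal (fun _ => ((1 : ℝ) : ℂ)) * Vᴴ) := by
      have h1 : V * diagonal (fun _ => ((1 : ℝ) : ℂ)) * Vᴴ = 1 := by
        simp [hV2]
      rw [h1, mul_one]
      conv_lhs => rw [hρe]
      have : U * diagonal (fun i => (p i : ℂ)) * Uᴴ *
          (U * diagonal (fun i => (Real.log (p i) : ℂ)) * Uᴴ)
          = U * (diagonal (fun i => (p i : ℂ)) * (Uᴴ * U) *
            diagonal (fun i => (Real.log (p i) : ℂ))) * Uᴴ := by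
        simp only [mul_assoc]
      rw [this, hU1, mul_one, diagonal_mul_diagonal]
      simp
    rw [e1, hx_trace_pair]
    conv_lhs => enter [1, 2]; rw [hρe]
    rw [hx_trace_pair, ← Complex.ofReal_sub, Complex.ofReal_re, ← Finset.sum_sub_distrib]
    refine Finset.sum_congr rfl fun i _ => ?_
    rw [← Finset.sum_sub_distrib]
    refine Finset.sum_congr rfl fun j _ => ?_
    ring
  · have h1 : V * diagonal (fun _ => ((1 : ℝ) : ℂ)) * Vᴴ = 1 := by
      simp [hV2]
    have e1 : ρ = (U * diagonal (fun i => (p i : ℂ)) * Uᴴ) *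
        (V * diagonal (fun _ => ((1 : ℝ) : ℂ)) * Vᴴ) := by rw [h1, mul_one, ← hρe]
    conv_lhs => rw [e1]
    rw [hx_trace_pair, Complex.ofReal_re]
    simp
  · intro t ht
    set W := Vᴴ * U with hW
    let Y : Matrix n n ℂ := fun i j => W i j * ((p j / (t * p j + s i) : ℝ) : ℂ)
    have hVW : V * W = U := by rw [hW, ← mul_assoc, hV2, one_mul]
    refine ⟨V * Y * Uᴴ, ?_, ?_⟩
    · have e1 : V * Y * Uᴴ * ρ = V * (Y * diagonal (fun i => (p i : ℂ))) * Uᴴ := by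
        rw [hρe]
        calc _ = V * Y * (Uᴴ * U) * diagonal (fun i => (p i : ℂ)) * Uᴴ := by
              simp only [mul_assoc]
          _ = _ := by rw [hU1, mul_one]; simp only [mul_assoc]
      have e2 : σ * (V * Y * Uᴴ) = V * (diagonal (fun i => (s i : ℂ)) * Y) * Uᴴ := by
        rw [hσe]
        calc _ = V * diagonal (fun i => (s i : ℂ)) * (Vᴴ * V) * Y * Uᴴ := by
              simp only [mul_assoc]
          _ = _ := by rw [hV1, mul_one]; simp only [mul_assoc]
      have e3 : (t : ℂ) • (Y * diagonal (fun i => (p i : ℂ))) + diagonal (fun i => (s i : ℂ)) * Y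
          = W * diagonal (fun i => (p i : ℂ)) := by
        ext i j
        rw [Matrix.add_apply, Matrix.smul_apply, mul_diagonal, diagonal_mul, mul_diagonal]
        have h0 : (t * p j + s i) ≠ 0 := by
          have := mul_nonneg ht (hp0 j).le
          have := hs0 i
          positivity
        have h0' : ((t : ℂ) * p j + s i) ≠ 0 := by exact_mod_cast h0
        simp only [Y, smul_eq_mul]
        push_cast
        field_simp
      rw [e1, e2, ← smul_mul_assoc, ← mul_smul_comm, ← add_mul, ← mul_add, e3, ← mul_assoc, hVW,
        ← hρe]
    · have e1 : ((V * Y * Uᴴ)ᴴ * ρ).trace = (Yᴴ * (W * diagonal (fun i => (p i : ℂ)))).trace := by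
        rw [conjTranspose_mul, conjTranspose_mul, conjTranspose_conjTranspose]
        conv_lhs => rw [hρe]
        rw [← mul_assoc, trace_mul_comm, hW]
        have : Uᴴ * (U * (Yᴴ * Vᴴ) * (U * diagonal fun i => (p i : ℂ)))
          = (Uᴴ * U) * (Yᴴ * Vᴴ) * (U * diagonal fun i => (p i : ℂ)) := by simp only [mul_assoc]
        rw [this, hU1, one_mul]
        simp only [mul_assoc]
      rw [e1]
      have e2 : (Yᴴ * (W * diagonal (fun i => (p i : ℂ)))).trace
          = ((∑ i, ∑ j, Complex.normSq (W i j) * (p j * (p j / (t * p j + s i))) : ℝ) : ℂ) := by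
        rw [Finset.sum_comm, Matrix.trace]
        push_cast
        refine Finset.sum_congr rfl fun j _ => ?_
        rw [diag_apply, Matrix.mul_apply]
        refine Finset.sum_congr rfl fun i _ => ?_
        rw [mul_diagonal, conjTranspose_apply]
        simp only [Y]
        rw [Complex.normSq_eq_conj_mul_self, star_mul']
        simp only [RCLike.star_def, Complex.conj_ofReal]
        push_cast
        ring
      rw [e2, Complex.ofReal_re]

/-- quadratic functional -/
def hxJ (t : ℝ) (ρ σ X : Matrix n n ℂ) : ℝ :=
  2 * ((Xᴴ * ρ).trace).re - t * ((X * ρ * Xᴴ).trace).re - ((Xᴴ * σ * X).trace).re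

lemma hx_re_trace_star (A : Matrix n n ℂ) : (Aᴴ.trace).re = (A.trace).re := by
  rw [trace_conjTranspose]; simp

lemma hxJ_opt {t : ℝ} {ρ σ X : Matrix n n ℂ}
    (hX : (t : ℂ) • (X * ρ) + σ * X = ρ) : hxJ t ρ σ X = ((Xᴴ * ρ).trace).re := by
  have h : (Xᴴ * ρ).trace = t * (X * ρ * Xᴴ).trace + (Xᴴ * σ * X).trace := by
    conv_lhs => rw [← hX]
    rw [mul_add, trace_add, mul_smul_comm, trace_smul, smul_eq_mul, trace_mul_comm, ← mul_assoc]
  have := congrArg Complex.re h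
  rw [Complex.add_re, Complex.re_ofReal_mul] at this
  unfold hxJ
  linarith

lemma hxJ_le {t : ℝ} (ht : 0 ≤ t) {ρ σ X : Matrix n n ℂ} (hρ : ρ.PosDef) (hσ : σ.PosDef)
    (hX : (t : ℂ) • (X * ρ) + σ * X = ρ) (Z : Matrix n n ℂ) :
    hxJ t ρ σ Z ≤ ((Xᴴ * ρ).trace).re := by
  have key : ∀ D : Matrix n n ℂ, hxJ t ρ σ (X + D) = hxJ t ρ σ X -
      (t * ((D * ρ * Dᴴ).trace).re + ((Dᴴ * σ * D).trace).re) := by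
    intro D
    have h1 : (Dᴴ * ρ).trace = t * (X * ρ * Dᴴ).trace + (Dᴴ * σ * X).trace := by
      conv_lhs => rw [← hX]
      rw [mul_add, trace_add, mul_smul_comm, trace_smul, smul_eq_mul, trace_mul_comm, ← mul_assoc]
    have h1 := congrArg Complex.re h1
    rw [Complex.add_re, Complex.re_ofReal_mul] at h1
    have h2 : ((D * ρ * Xᴴ).trace).re = ((X * ρ * Dᴴ).trace).re := by
      rw [← hx_re_trace_star]
      simp [conjTranspose_mul, hρ.1.eq, mul_assoc]
    have h3 : ((Xᴴ * σ * D).trace).re = ((Dᴴ * σ * X).trace).re := by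
      rw [← hx_re_trace_star]
      simp [conjTranspose_mul, hσ.1.eq, mul_assoc]
    unfold hxJ
    simp only [conjTranspose_add, add_mul, mul_add, trace_add, Complex.add_re]
    rw [h2, h3, h1]
    ring
  have := key (Z - X)
  rw [add_sub_cancel, hxJ_opt hX] at this
  rw [this]
  have p1 : 0 ≤ (((Z - X) * ρ * (Z - X)ᴴ).trace).re :=
    (Complex.le_def.1 (hρ.posSemidef.mul_mul_conjTranspose_same (Z - X)).trace_nonneg).1
  have p2 : 0 ≤ (((Z - X)ᴴ * σ * (Z - X)).trace).re :=
    (Complex.le_def.1 (hσ.posSemidef.conjTranspose_mul_mul_same (Z - X)).trace_nonneg).1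
  have := mul_nonneg ht p1
  linarith

lemma hx_syl_unique {t : ℝ} (ht : 0 ≤ t) {ρ σ D : Matrix n n ℂ} (hρ : ρ.PosDef) (hσ : σ.PosDef)
    (hX : (t : ℂ) • (D * ρ) + σ * D = 0) : D = 0 := by
  have h1 : (0 : ℂ) = t * (D * ρ * Dᴴ).trace + (Dᴴ * σ * D).trace := by
    have : (Dᴴ * ((t : ℂ) • (D * ρ) + σ * D)).trace = 0 := by rw [hX]; simp
    rw [← this]
    rw [mul_add, trace_add, mul_smul_comm, trace_smul, smul_eq_mul, trace_mul_comm, ← mul_assoc]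
  have p1 := (hρ.posSemidef.mul_mul_conjTranspose_same D).trace_nonneg
  have p2 := (hσ.posSemidef.conjTranspose_mul_mul_same D)
  have p3 : (Dᴴ * σ * D).trace = 0 := by
    have ht' : (0 : ℂ) ≤ t := by exact_mod_cast ht
    have := mul_nonneg ht' p1
    apply le_antisymm _ p2.trace_nonneg
    rw [h1]
    exact le_add_of_nonneg_left this
  have p4 := p2.trace_eq_zero_iff.1 p3
  by_contra hD
  obtain ⟨v, hv⟩ : ∃ v, D *ᵥ v ≠ 0 := by
    by_contra! hh
    exact hD (Matrix.ext_of_mulVec_single fun i => by rw [hh, zero_mulVec])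
  have := hσ.dotProduct_mulVec_pos hv
  have e : star (D *ᵥ v) ⬝ᵥ σ *ᵥ D *ᵥ v = star v ⬝ᵥ (Dᴴ * σ * D) *ᵥ v := by
    rw [star_mulVec, ← dotProduct_mulVec]
    simp only [mulVec_mulVec, mul_assoc]
  rw [e, p4] at this
  simp at this

lemma hx_int (p s T : ℝ) (hp : 0 < p) (hs : 0 < s) (hT : 0 ≤ T) :
    IntervalIntegrable (fun t => p / (t * p + s)) MeasureTheory.volume 0 T ∧
    ∫ t in (0 : ℝ)..T, p / (t * p + s) = Real.log (T * p + s) - Real.log s := by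
  have hpos : ∀ t ∈ Set.uIcc 0 T, 0 < t * p + s := by
    intro t ht
    rw [Set.uIcc_of_le hT] at ht
    have := mul_nonneg ht.1 hp.le
    linarith
  have hc : IntervalIntegrable (fun t => p / (t * p + s)) MeasureTheory.volume 0 T := by
    apply ContinuousOn.intervalIntegrable
    apply ContinuousOn.div (by fun_prop) (by fun_prop)
    intro t ht
    exact (hpos t ht).ne'
  refine ⟨hc, ?_⟩
  have := intervalIntegral.integral_eq_sub_of_hasDerivAt (a := 0) (b := T)
    (f := fun t => Real.log (t * p + s)) (f' := fun t => p / (t * p + s)) ?_ hc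
  · simpa using this
  · intro t ht
    have h1 : HasDerivAt (fun t => t * p + s) p t := by
      simpa using ((hasDerivAt_id t).mul_const p).add_const s
    exact h1.log (hpos t ht).ne'

lemma hx_lim (p s : ℝ) (hp : 0 < p) (hs : 0 < s) :
    Filter.Tendsto (fun T : ℝ => Real.log (T * p + s) - Real.log T) Filter.atTop
      (nhds (Real.log p)) := by
  have h1 : Filter.Tendsto (fun T : ℝ => p + s / T) Filter.atTop (nhds (p + 0)) :=
    tendsto_const_nhds.add (tendsto_const_nhds.div_atTop Filter.tendsto_id)
  rw [add_zero] at h1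
  have h2 := h1.log hp.ne'
  refine h2.congr' ?_
  filter_upwards [Filter.eventually_gt_atTop 0] with T hT
  rw [← Real.log_div (by positivity) hT.ne']
  congr 1
  field_simp

/-- data processing -/
lemma hx_dpi {ρ σ ρ' σ' : Matrix n n ℂ} (hρ : ρ.PosDef) (hσ : σ.PosDef) (hρ' : ρ'.PosDef)
    (hσ' : σ'.PosDef) (E : Matrix n n ℂ →ₗ[ℂ] Matrix n n ℂ)
    (hstar : ∀ X, E Xᴴ = (E X)ᴴ)
    (hmul : ∀ Y Z, E Y = Y → E Z = Z → E (Y * Z) = Y * Z)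
    (hl : ∀ X Y, E Y = Y → E (Y * X) = Y * E X)
    (hr : ∀ X Y, E Y = Y → E (X * Y) = E X * Y)
    (h1 : E ρ' = ρ') (h2 : E σ' = σ') (htr : ρ.trace = ρ'.trace)
    (h3 : ∀ Y, E Y = Y → (Y * ρ).trace = (Y * ρ').trace)
    (h4 : ∀ Y, E Y = Y → (Y * σ).trace = (Y * σ').trace) :
    relEnt ρ' σ' ≤ relEnt ρ σ := by
  obtain ⟨w, p, s, hw, hp, hs, hD, hTr, hG⟩ := hx_spec_pair hρ hσ
  obtain ⟨w', p', s', hw', hp', hs', hD', hTr', hG'⟩ := hx_spec_pair hρ' hσ'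
  have hpt : ∀ t : ℝ, 0 ≤ t → ∑ i, ∑ j, w' i j * (p' j * (p' j / (t * p' j + s' i)))
      ≤ ∑ i, ∑ j, w i j * (p j * (p j / (t * p j + s i))) := by
    intro t ht
    obtain ⟨X, hX, hXe⟩ := hG t ht
    obtain ⟨X', hX', hXe'⟩ := hG' t ht
    rw [← hXe, ← hXe', ← hxJ_opt hX']
    have hE : E X' = X' := by
      have := congrArg E hX'
      rw [map_add, map_smul, hr _ _ h1, hl _ _ h2, h1] at this
      have h0 : (t : ℂ) • ((E X' - X') * ρ') + σ' * (E X' - X') = 0 := by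
        rw [sub_mul, mul_sub, smul_sub]
        calc _ = ((t : ℂ) • (E X' * ρ') + σ' * E X') - ((t : ℂ) • (X' * ρ') + σ' * X') := by abel
          _ = 0 := by rw [this, hX', sub_self]
      exact sub_eq_zero.1 (hx_syl_unique ht hρ' hσ' h0)
    have hE' : E X'ᴴ = X'ᴴ := by rw [hstar, hE]
    have hJ : hxJ t ρ' σ' X' = hxJ t ρ σ X' := by
      unfold hxJ
      rw [h3 _ hE']
      have a1 : (X' * ρ' * X'ᴴ).trace = (X' * ρ * X'ᴴ).trace := by
        rw [trace_mul_comm, ← mul_assoc, trace_mul_comm (X' * ρ), ← mul_assoc,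
          h3 _ (hmul _ _ hE' hE)]
      have a2 : (X'ᴴ * σ' * X').trace = (X'ᴴ * σ * X').trace := by
        rw [trace_mul_comm, ← mul_assoc, trace_mul_comm (X'ᴴ * σ), ← mul_assoc,
          h4 _ (hmul _ _ hE hE')]
      rw [a1, a2]
    rw [hJ]
    exact hxJ_le ht hρ hσ hX X'
  have hI : ∀ (w : n → n → ℝ) (p s : n → ℝ), (∀ j, 0 < p j) → (∀ i, 0 < s i) → ∀ T : ℝ, 0 ≤ T →
      IntervalIntegrable (fun t => ∑ i, ∑ j, w i j * (p j * (p j / (t * p j + s i))))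
        MeasureTheory.volume 0 T ∧
      ∫ t in (0 : ℝ)..T, ∑ i, ∑ j, w i j * (p j * (p j / (t * p j + s i)))
        = ∑ i, ∑ j, w i j * (p j * (Real.log (T * p j + s i) - Real.log (s i))) := by
    intro w p s hp hs T hT
    have hi : ∀ i j, IntervalIntegrable (fun t => w i j * (p j * (p j / (t * p j + s i))))
        MeasureTheory.volume 0 T := fun i j =>
      ((hx_int (p j) (s i) T (hp j) (hs i) hT).1.const_mul _).const_mul _
    have hi2 : ∀ i, IntervalIntegrable (fun t => ∑ j, w i j * (p j * (p j / (t * p j + s i))))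
        MeasureTheory.volume 0 T := by
      intro i
      have := IntervalIntegrable.sum Finset.univ (fun j _ => hi i j)
      simpa [Finset.sum_fn] using this
    constructor
    · have := IntervalIntegrable.sum Finset.univ (fun j _ => hi2 j)
      simpa [Finset.sum_fn] using this
    · rw [intervalIntegral.integral_finsetSum (fun i _ => hi2 i)]
      refine Finset.sum_congr rfl fun i _ => ?_
      rw [intervalIntegral.integral_finsetSum (fun j _ => hi i j)]
      refine Finset.sum_congr rfl fun j _ => ?_
      rw [intervalIntegral.integral_const_mul, intervalIntegral.integral_const_mul,
        (hx_int (p j) (s i) T (hp j) (hs i) hT).2]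
  have hL : ∀ (w : n → n → ℝ) (p s : n → ℝ), (∀ j, 0 < p j) → (∀ i, 0 < s i) →
      Filter.Tendsto (fun T : ℝ =>
        (∑ i, ∑ j, w i j * (p j * (Real.log (T * p j + s i) - Real.log (s i))))
          - (∑ i, ∑ j, w i j * p j) * Real.log T) Filter.atTop
        (nhds (∑ i, ∑ j, w i j * (p j * (Real.log (p j) - Real.log (s i))))) := by
    intro w p s hp hs
    have : Filter.Tendsto (fun T : ℝ => ∑ i, ∑ j, w i j * (p j *
        ((Real.log (T * p j + s i) - Real.log T) - Real.log (s i)))) Filter.atTop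
        (nhds (∑ i, ∑ j, w i j * (p j * (Real.log (p j) - Real.log (s i))))) := by
      refine tendsto_finsetSum _ fun i _ => tendsto_finsetSum _ fun j _ => ?_
      exact (((hx_lim (p j) (s i) (hp j) (hs i)).sub_const _).const_mul _).const_mul _
    refine this.congr fun T => ?_
    rw [Finset.sum_mul, ← Finset.sum_sub_distrib]
    refine Finset.sum_congr rfl fun i _ => ?_
    rw [Finset.sum_mul, ← Finset.sum_sub_distrib]
    refine Finset.sum_congr rfl fun j _ => ?_
    ring
  rw [hD, hD']
  refine le_of_tendsto_of_tendsto (hL w' p' s' hp' hs') (hL w p s hp hs) ?_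
  filter_upwards [Filter.eventually_ge_atTop 0] with T hT
  rw [← hTr, ← hTr', htr]
  apply sub_le_sub_right
  rw [← (hI w' p' s' hp' hs' T hT).2, ← (hI w p s hp hs T hT).2]
  apply intervalIntegral.integral_mono_on hT (hI w' p' s' hp' hs' T hT).1 (hI w p s hp hs T hT).1
  intro t ht
  exact hpt t ht.1

end dpi

section ce
variable {n : Type*} [Fintype n] [DecidableEq n]

lemma hx_psd_decomp {A : Matrix n n ℂ} (hA : A.PosSemidef) : ∃ B : Matrix n n ℂ, A = Bᴴ * B := by
  open scoped MatrixOrder in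
  obtain ⟨B, hB⟩ := CStarAlgebra.nonneg_iff_eq_star_mul_self.mp hA.nonneg
  exact ⟨B, hB⟩

lemma hx_pd_conj {σ D : Matrix n n ℂ} (hσ : σ.PosDef) (h : Dᴴ * σ * D = 0) : D = 0 := by
  apply hx_syl_unique (le_refl 0) hσ hσ
  simp only [Complex.ofReal_zero, zero_smul, zero_add]
  obtain ⟨B, hB⟩ := hx_psd_decomp hσ.posSemidef
  have : (B * D)ᴴ * (B * D) = 0 := by
    rw [conjTranspose_mul, ← h, hB]; simp only [mul_assoc]
  rw [conjTranspose_mul_self_eq_zero] at this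
  rw [hB, mul_assoc, this, mul_zero]

lemma hx_tr_nonneg {A B : Matrix n n ℂ} (hA : A.PosSemidef) (hB : B.PosSemidef) :
    0 ≤ (A * B).trace := by
  obtain ⟨C, rfl⟩ := hx_psd_decomp hB
  rw [← mul_assoc, trace_mul_comm, ← mul_assoc]
  exact (hA.mul_mul_conjTranspose_same C).trace_nonneg

lemma hx_tr_zero {A B : Matrix n n ℂ} (hA : A.PosDef) (hB : B.PosSemidef)
    (h : (A * B).trace = 0) : B = 0 := by
  obtain ⟨C, rfl⟩ := hx_psd_decomp hB
  rw [← mul_assoc, trace_mul_comm, ← mul_assoc] at h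
  have h2 := (hA.posSemidef.mul_mul_conjTranspose_same C).trace_eq_zero_iff.1 h
  have : Cᴴ = 0 := hx_pd_conj hA (by rwa [conjTranspose_conjTranspose])
  rw [this, zero_mul]

lemma hx_tr_vec (A : Matrix n n ℂ) (v : n → ℂ) :
    (A * vecMulVec v (star v)).trace = star v ⬝ᵥ (A *ᵥ v) := by
  rw [mul_vecMulVec, trace_vecMulVec, dotProduct_comm]

lemma hx_span_psd (S : Submodule ℂ (Matrix n n ℂ)) (h : ∀ A : Matrix n n ℂ, A.PosSemidef → A ∈ S)
    (X : Matrix n n ℂ) : X ∈ S := by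
  open scoped MatrixOrder Matrix.Norms.L2Operator in
  have h1 : Submodule.span ℂ {a : Matrix n n ℂ | 0 ≤ a} = ⊤ := CStarAlgebra.span_nonneg
  have h2 : Submodule.span ℂ {a : Matrix n n ℂ | 0 ≤ a} ≤ S := by
    rw [Submodule.span_le]
    intro a ha
    exact h a (Matrix.nonneg_iff_posSemidef.1 ha)
  rw [h1] at h2
  exact h2 trivial

lemma hx_comm_psd {A B : Matrix n n ℂ} (hA : A.PosSemidef) (hB : B.PosSemidef)
    (h : A * B = B * A) : (A * B).PosSemidef := by
  open scoped MatrixOrder Matrix.Norms.L2Operator in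
  exact Matrix.nonneg_iff_posSemidef.1 (Commute.mul_nonneg hA.nonneg hB.nonneg h)

structure HxCE (E Es : Matrix n n ℂ →ₗ[ℂ] Matrix n n ℂ) (σ : Matrix n n ℂ) : Prop where
  proj : ∀ X, E (E X) = E X
  unital : E 1 = 1
  pos : ∀ X, X.PosSemidef → (E X).PosSemidef
  bimod : ∀ X Y Z, E Y = Y → E Z = Z → E (Y * X * Z) = Y * E X * Z
  pd : σ.PosDef
  inv : ∀ X, (σ * E X).trace = (σ * X).trace
  adj : ∀ X Y, (Es X * Y).trace = (X * E Y).trace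

/-- trace-preserving expectation -/
def hxF (Es : Matrix n n ℂ →ₗ[ℂ] Matrix n n ℂ) (ω : Matrix n n ℂ) : Matrix n n ℂ :=
  (Es 1)⁻¹ * Es ω

/-- minus entropy -/
def hxPhi (X : Matrix n n ℂ) : ℝ := ((X * matLog X).trace).re

namespace HxCE
variable {E Es : Matrix n n ℂ →ₗ[ℂ] Matrix n n ℂ} {σ : Matrix n n ℂ}

lemma hl (h : HxCE E Es σ) (X Y : Matrix n n ℂ) (hY : E Y = Y) : E (Y * X) = Y * E X := by
  simpa using h.bimod X Y 1 hY h.unital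

lemma hr (h : HxCE E Es σ) (X Y : Matrix n n ℂ) (hY : E Y = Y) : E (X * Y) = E X * Y := by
  simpa using h.bimod X 1 Y h.unital hY

lemma hmul (h : HxCE E Es σ) (X Y : Matrix n n ℂ) (hX : E X = X) (hY : E Y = Y) :
    E (X * Y) = X * Y := by
  rw [h.hr _ _ hY, hX]

lemma star (h : HxCE E Es σ) (X : Matrix n n ℂ) : E Xᴴ = (E X)ᴴ := by
  let S : Submodule ℂ (Matrix n n ℂ) :=
    { carrier := {X | E Xᴴ = (E X)ᴴ}
      add_mem' := by
        intro a b ha hb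
        simp only [Set.mem_ofPred_eq] at *
        simp [conjTranspose_add, ha, hb]
      zero_mem' := by simp
      smul_mem' := by
        intro c a ha
        simp only [Set.mem_ofPred_eq] at *
        simp [conjTranspose_smul, ha] }
  refine hx_span_psd S ?_ X
  intro A hA
  change E Aᴴ = (E A)ᴴ
  rw [hA.1.eq, (h.pos A hA).1.eq]

lemma adj' (h : HxCE E Es σ) (X Y : Matrix n n ℂ) : (Y * Es X).trace = (E Y * X).trace := by
  rw [trace_mul_comm, h.adj, trace_mul_comm]

lemma es_star (h : HxCE E Es σ) (X : Matrix n n ℂ) : Es Xᴴ = (Es X)ᴴ := by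
  rw [Matrix.ext_iff_trace_mul_right]
  intro Y
  rw [h.adj]
  have e1 : Xᴴ * E Y = (E Yᴴ * X)ᴴ := by
    rw [conjTranspose_mul, h.star, conjTranspose_conjTranspose]
  have e2 : (Es X)ᴴ * Y = (Yᴴ * Es X)ᴴ := by
    rw [conjTranspose_mul, conjTranspose_conjTranspose]
  rw [e1, e2, trace_conjTranspose, trace_conjTranspose, h.adj']

lemma es_psd (h : HxCE E Es σ) {ω : Matrix n n ℂ} (hω : ω.PosSemidef) : (Es ω).PosSemidef := by
  apply PosSemidef.of_dotProduct_mulVec_nonneg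
  · rw [IsHermitian, ← h.es_star, hω.1.eq]
  · intro v
    rw [← hx_tr_vec, h.adj]
    exact hx_tr_nonneg hω (h.pos _ (posSemidef_vecMulVec_self_star v))

lemma es_pd (h : HxCE E Es σ) {ω : Matrix n n ℂ} (hω : ω.PosDef) : (Es ω).PosDef := by
  apply PosDef.of_dotProduct_mulVec_pos
  · exact (h.es_psd hω.posSemidef).1
  · intro v hv
    have hp := h.pos _ (posSemidef_vecMulVec_self_star v)
    rw [← hx_tr_vec, h.adj]
    apply lt_of_le_of_ne (hx_tr_nonneg hω.posSemidef hp)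
    intro h0
    have h1 := hx_tr_zero hω hp h0.symm
    have h2 : (σ * vecMulVec v (Star.star v)).trace = 0 := by rw [← h.inv, h1]; simp
    have h3 := hx_tr_zero h.pd (posSemidef_vecMulVec_self_star v) h2
    rw [vecMulVec_eq_zero] at h3
    simp [hv] at h3

lemma T_pd (h : HxCE E Es σ) : (Es 1).PosDef := h.es_pd PosDef.one

lemma T_inv (h : HxCE E Es σ) : Es 1 * (Es 1)⁻¹ = 1 :=
  mul_nonsing_inv _ ((isUnit_iff_isUnit_det _).1 h.T_pd.isUnit)

lemma T_inv' (h : HxCE E Es σ) : (Es 1)⁻¹ * Es 1 = 1 :=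
  nonsing_inv_mul _ ((isUnit_iff_isUnit_det _).1 h.T_pd.isUnit)

lemma trT (h : HxCE E Es σ) (Y : Matrix n n ℂ) : (Es 1 * Y).trace = (E Y).trace := by
  rw [h.adj, one_mul]

lemma T_comm (h : HxCE E Es σ) {Y : Matrix n n ℂ} (hY : E Y = Y) : Es 1 * Y = Y * Es 1 := by
  rw [Matrix.ext_iff_trace_mul_right]
  intro X
  rw [mul_assoc, h.trT, h.hl _ _ hY, trace_mul_comm, ← h.hr _ _ hY, ← h.trT, ← mul_assoc,
    trace_mul_comm, mul_assoc]

lemma T_mul_F (h : HxCE E Es σ) (ω : Matrix n n ℂ) : Es 1 * hxF Es ω = Es ω := by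
  rw [hxF, ← mul_assoc, h.T_inv, one_mul]

lemma T_cancel (h : HxCE E Es σ) {X Y : Matrix n n ℂ} (e : Es 1 * X = Es 1 * Y) : X = Y := by
  have := congrArg ((Es 1)⁻¹ * ·) e
  simpa [← mul_assoc, h.T_inv'] using this

lemma E_F (h : HxCE E Es σ) (ω : Matrix n n ℂ) : E (hxF Es ω) = hxF Es ω := by
  apply h.T_cancel
  rw [Matrix.ext_iff_trace_mul_right]
  intro Y
  rw [mul_assoc, h.trT, h.hl _ _ (h.proj _), ← h.hr _ _ (h.proj _), ← h.trT, ← mul_assoc,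
    h.T_mul_F, h.adj, h.proj, h.adj]

lemma E_Tinv (h : HxCE E Es σ) : E (Es 1)⁻¹ = 1 := by
  apply h.T_cancel
  rw [Matrix.ext_iff_trace_mul_right]
  intro Y
  rw [mul_assoc, h.trT, h.hl _ _ (h.proj _), ← h.hr _ _ (h.proj _), ← h.trT, ← mul_assoc,
    h.T_inv, one_mul, mul_one, h.trT]

lemma tr_F (h : HxCE E Es σ) (ω Y : Matrix n n ℂ) (hY : E Y = Y) :
    (Y * hxF Es ω).trace = (Y * ω).trace := by
  rw [hxF, ← mul_assoc, h.adj', h.hl _ _ hY, h.E_Tinv, mul_one]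

lemma F_comm (h : HxCE E Es σ) (ω : Matrix n n ℂ) : Es 1 * hxF Es ω = hxF Es ω * Es 1 :=
  h.T_comm (h.E_F ω)

lemma F_psd (h : HxCE E Es σ) {ω : Matrix n n ℂ} (hω : ω.PosSemidef) : (hxF Es ω).PosSemidef := by
  apply hx_comm_psd h.T_pd.inv.posSemidef (h.es_psd hω)
  apply h.T_cancel
  rw [← mul_assoc, h.T_inv, one_mul]
  conv_rhs => rw [← h.T_mul_F ω]
  rw [h.F_comm ω, mul_assoc, h.T_inv, mul_one, h.T_mul_F]

lemma F_pd (h : HxCE E Es σ) {ω : Matrix n n ℂ} (hω : ω.PosDef) : (hxF Es ω).PosDef := by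
  rw [(h.F_psd hω.posSemidef).posDef_iff_isUnit]
  exact h.T_pd.inv.isUnit.mul (h.es_pd hω).isUnit

lemma E_aeval (h : HxCE E Es σ) {A : Matrix n n ℂ} (hA : E A = A) (p : Polynomial ℝ) :
    E (Polynomial.aeval A p) = Polynomial.aeval A p := by
  induction p using Polynomial.induction_on' with
  | add p q hp hq => simp [hp, hq]
  | monomial k c =>
    have hk : E (A ^ k) = A ^ k := by
      induction k with
      | zero => simpa using h.unital
      | succ k ih => rw [pow_succ, h.hmul _ _ ih hA]
    rw [Polynomial.aeval_monomial, Algebra.algebraMap_eq_smul_one, smul_mul_assoc, one_mul]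
    have : c • A ^ k = (c : ℂ) • A ^ k := by ext i j; simp
    rw [this, map_smul, hk]

lemma E_cfc (h : HxCE E Es σ) {A : Matrix n n ℂ} (hA : E A = A) (hH : A.IsHermitian) (f : ℝ → ℝ) :
    E (cfc f A) = cfc f A := by
  obtain ⟨p, hp, -⟩ := hx_poly hH f
  rw [hp, h.E_aeval hA]

lemma supp (h : HxCE E Es σ) {ρ R : Matrix n n ℂ} (hρ : ρ.PosSemidef)
    (hR : hxF Es ρ * R = 0) : ρ * R = 0 := by
  have hFH : (hxF Es ρ).IsHermitian := (h.F_psd hρ).1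
  set F := hxF Es ρ with hF
  set P := cfc (fun x : ℝ => if x = 0 then (1 : ℝ) else 0) F with hP
  have hFP : F * P = 0 := by
    have := hx_mul_ind hFH 0
    simpa using this
  have hPR : P * R = R := by
    have := hx_cfc_mul hFH (l := 0) (R := R) (by simpa using hR)
      (fun x : ℝ => if x = 0 then (1 : ℝ) else 0)
    simpa using this
  have hPP : P * P = P := by
    have := hx_cfc_mul hFH (l := 0) (R := P) (by simpa using hFP)
      (fun x : ℝ => if x = 0 then (1 : ℝ) else 0)
    simpa using this
  have hPH : Pᴴ = P := by
    have : IsSelfAdjoint P := cfc_predicate _ _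
    exact this
  have hEP : E P = P := h.E_cfc (h.E_F ρ) hFH _
  obtain ⟨B, hB⟩ := hx_psd_decomp hρ
  have ht : ((B * P)ᴴ * (B * P)).trace = 0 := by
    have : (B * P)ᴴ * (B * P) = P * ρ * P := by
      rw [conjTranspose_mul, hPH, hB]; simp only [mul_assoc]
    rw [this, trace_mul_comm, ← mul_assoc, hPP, ← h.tr_F ρ P hEP, trace_mul_comm, ← hF, hFP]
    simp
  rw [trace_conjTranspose_mul_self_eq_zero_iff] at ht
  rw [← hPR, hB, ← mul_assoc, mul_assoc Bᴴ, ht]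
  simp

lemma relEnt_eq (h : HxCE E Es σ) {ρ : Matrix n n ℂ} (hρ : ρ.PosSemidef) :
    relEnt ρ (Es ρ) = hxPhi ρ - hxPhi (hxF Es ρ) - ((ρ * matLog (Es 1)).trace).re := by
  have hFH : (hxF Es ρ).IsHermitian := (h.F_psd hρ).1
  have key : ρ * (matLog (Es ρ) - matLog (Es 1) - matLog (hxF Es ρ)) = 0 := by
    apply hx_joint h.T_pd.1 hFH (h.F_comm ρ)
    intro t s R h1 h2
    by_cases hR0 : R = 0
    · simp [hR0]
    have ht : t ≠ 0 := by
      rintro rfl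
      apply hR0
      apply h.T_cancel
      rw [h1]; simp
    have h3 : Es ρ * R = ((t * s : ℝ) : ℂ) • R := by
      rw [← h.T_mul_F ρ, mul_assoc, h2, mul_smul_comm, h1, smul_smul]
      push_cast
      rw [mul_comm]
    rw [mul_assoc, sub_mul, sub_mul]
    unfold matLog
    rw [hx_cfc_mul h.T_pd.1 h1, hx_cfc_mul hFH h2, hx_cfc_mul (h.es_psd hρ).1 h3]
    by_cases hs : s = 0
    · subst hs
      have : ρ * R = 0 := h.supp hρ (by rw [h2]; simp)
      simp [mul_sub, this]
    · rw [Real.log_mul ht hs]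
      push_cast
      rw [add_smul]
      simp
  have k2 : ρ * matLog (Es ρ) = ρ * matLog (Es 1) + ρ * matLog (hxF Es ρ) := by
    rw [mul_sub, mul_sub] at key
    rw [sub_sub, sub_eq_zero] at key
    exact key
  have k3 : (ρ * matLog (hxF Es ρ)).trace = (hxF Es ρ * matLog (hxF Es ρ)).trace := by
    rw [trace_mul_comm, trace_mul_comm (hxF Es ρ)]
    exact (h.tr_F ρ _ (h.E_cfc (h.E_F ρ) hFH _)).symm
  unfold relEnt hxPhi
  rw [mul_sub, k2, trace_sub, trace_add, k3]
  simp only [Complex.sub_re, Complex.add_re]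
  ring

end HxCE

lemma hxPhi_lim {X : Matrix n n ℂ} (hX : X.PosSemidef) :
    Filter.Tendsto (fun ε : ℝ => hxPhi (X + (ε : ℂ) • 1)) (nhds 0) (nhds (hxPhi X)) := by
  obtain ⟨U, p, h1, h2, hp, h3, h4⟩ := hx_diag hX.1
  have hfin : (spectrum ℝ X).Finite := Matrix.finite_real_spectrum
  have key : ∀ ε : ℝ, hxPhi (X + (ε : ℂ) • 1) = ∑ i, (p i + ε) * Real.log (p i + ε) := by
    intro ε
    have e1 : X + (ε : ℂ) • 1 = cfc (fun x : ℝ => x + ε) X := by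
      rw [h4]
      conv_lhs => rw [h3]
      have : diagonal (fun i => ((p i + ε : ℝ) : ℂ)) = diagonal (fun i => (p i : ℂ))
          + (ε : ℂ) • (1 : Matrix n n ℂ) := by
        ext i j
        by_cases hij : i = j
        · subst hij; simp
        · simp [hij]
      rw [this, mul_add, add_mul, mul_smul_comm, smul_mul_assoc, mul_one, h2]
    unfold hxPhi matLog
    have e2 : cfc Real.log (cfc (fun x : ℝ => x + ε) X) = cfc (fun x : ℝ => Real.log (x + ε)) X :=
      (cfc_comp' Real.log (fun x : ℝ => x + ε) X ((hfin.image _).continuousOn _) (by fun_prop)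
        hX.1).symm
    rw [e1, e2, h4, h4]
    have : ∀ d1 d2 : n → ℂ, (U * diagonal d1 * Uᴴ * (U * diagonal d2 * Uᴴ)).trace
        = ∑ i, d1 i * d2 i := by
      intro d1 d2
      have : U * diagonal d1 * Uᴴ * (U * diagonal d2 * Uᴴ)
          = U * (diagonal d1 * (Uᴴ * U) * diagonal d2 * Uᴴ) := by simp only [mul_assoc]
      rw [this, trace_mul_comm, mul_assoc, h1, mul_one, mul_one, diagonal_mul_diagonal,
        trace_diagonal]
    rw [this]
    rw [Complex.re_sum]
    refine Finset.sum_congr rfl fun i _ => ?_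
    rw [← Complex.ofReal_mul, Complex.ofReal_re]
  have k0 : hxPhi X = ∑ i, (p i + 0) * Real.log (p i + 0) := by
    rw [← key 0]; simp
  simp only [key]
  rw [k0]
  refine tendsto_finsetSum _ fun i _ => ?_
  have hc : Continuous fun ε : ℝ => (p i + ε) * Real.log (p i + ε) :=
    Real.continuous_mul_log.comp (continuous_const.add continuous_id)
  exact hc.tendsto 0

end ce

section square
variable {n : Type*} [Fintype n] [DecidableEq n]
  {EA EB EAs EBs : Matrix n n ℂ →ₗ[ℂ] Matrix n n ℂ} {σ : Matrix n n ℂ}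

lemma HxCE.es_left {E Es : Matrix n n ℂ →ₗ[ℂ] Matrix n n ℂ} (h : HxCE E Es σ)
    {Y : Matrix n n ℂ} (hY : E Y = Y) (X : Matrix n n ℂ) : Es (Y * X) = Y * Es X := by
  rw [Matrix.ext_iff_trace_mul_right]
  intro Z
  rw [h.adj, mul_assoc, trace_mul_comm, mul_assoc, ← h.hr _ _ hY, ← h.adj, trace_mul_comm,
    mul_assoc, trace_mul_comm Z]

lemma HxCE.comp (hA : HxCE EA EAs σ) (hB : HxCE EB EBs σ) (hc : ∀ X, EA (EB X) = EB (EA X)) :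
    HxCE (EA ∘ₗ EB) (EBs ∘ₗ EAs) σ where
  proj X := by
    simp only [LinearMap.comp_apply]
    rw [← hc (EB X), hB.proj, hA.proj]
  unital := by simp [hA.unital, hB.unital]
  pos X hX := hA.pos _ (hB.pos _ hX)
  bimod X Y Z hY hZ := by
    simp only [LinearMap.comp_apply] at *
    have a1 : EA Y = Y := by rw [← hY, hA.proj]
    have a2 : EB Y = Y := by rw [← hY, hc, hB.proj]
    have b1 : EA Z = Z := by rw [← hZ, hA.proj]
    have b2 : EB Z = Z := by rw [← hZ, hc, hB.proj]
    rw [hB.bimod _ _ _ a2 b2, hA.bimod _ _ _ a1 b1]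
  pd := hA.pd
  inv X := by simp only [LinearMap.comp_apply]; rw [hA.inv, hB.inv]
  adj X Y := by simp only [LinearMap.comp_apply]; rw [hB.adj, hA.adj]

lemma hxF_add {E Es : Matrix n n ℂ →ₗ[ℂ] Matrix n n ℂ} (h : HxCE E Es σ)
    (X : Matrix n n ℂ) (c : ℂ) : hxF Es (X + c • 1) = hxF Es X + c • 1 := by
  unfold hxF
  rw [map_add, map_smul, mul_add, mul_smul_comm, h.T_inv']

lemma hx_square (hA : HxCE EA EAs σ) (hB : HxCE EB EBs σ) (hc : ∀ X, EA (EB X) = EB (EA X))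
    (fA : EA (EBs 1) = EBs 1) (fB : EB (EAs 1) = EAs 1) {ρ : Matrix n n ℂ} (hρ : ρ.PosSemidef) :
    relEnt ρ (EBs (EAs ρ)) ≤ relEnt ρ (EAs ρ) + relEnt ρ (EBs ρ) := by
  have hAB := hA.comp hB hc
  have hT : (EBs ∘ₗ EAs) 1 = EAs 1 * EBs 1 := by
    have := hB.es_left fB 1
    rw [mul_one] at this
    exact this
  have hTc : EAs 1 * EBs 1 = EBs 1 * EAs 1 := hA.T_comm fA
  have hsc : ∀ X, EAs (EBs X) = EBs (EAs X) := by
    intro X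
    rw [Matrix.ext_iff_trace_mul_right]
    intro Y
    rw [hA.adj, hB.adj, hB.adj, hA.adj, hc]
  have hF : ∀ ω, hxF EAs (hxF EBs ω) = hxF (EBs ∘ₗ EAs) ω := by
    intro ω
    apply hAB.T_cancel
    rw [hAB.T_mul_F, hT, hTc, mul_assoc, hA.T_mul_F, ← hA.es_left fA, hB.T_mul_F, hsc]
    rfl
  have ssa_pd : ∀ ω : Matrix n n ℂ, ω.PosDef → hxPhi (hxF EAs ω) + hxPhi (hxF EBs ω)
      ≤ hxPhi ω + hxPhi (hxF (EBs ∘ₗ EAs) ω) := by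
    intro ω hω
    have hABf := hAB.E_F ω
    have hd := hx_dpi hω (hB.F_pd hω) (hA.F_pd hω) (hA.F_pd (hB.F_pd hω)) EA hA.star hA.hmul
      hA.hl hA.hr (hA.E_F _) (hA.E_F _)
      (by simpa using (hA.tr_F ω 1 hA.unital).symm)
      (fun Y hY => (hA.tr_F _ Y hY).symm) (fun Y hY => (hA.tr_F _ Y hY).symm)
    rw [hF] at hd
    have e1 : relEnt ω (hxF EBs ω) = hxPhi ω - hxPhi (hxF EBs ω) := by
      have f0 : EB (matLog (hxF EBs ω)) = matLog (hxF EBs ω) :=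
        hB.E_cfc (hB.E_F ω) (hB.F_pd hω).1 Real.log
      unfold relEnt hxPhi
      rw [mul_sub, trace_sub, Complex.sub_re, trace_mul_comm ω (matLog (hxF EBs ω)),
        trace_mul_comm (hxF EBs ω),
        hB.tr_F ω _ f0]
    have e2 : relEnt (hxF EAs ω) (hxF (EBs ∘ₗ EAs) ω)
        = hxPhi (hxF EAs ω) - hxPhi (hxF (EBs ∘ₗ EAs) ω) := by
      have f1 : (EA ∘ₗ EB) (matLog (hxF (EBs ∘ₗ EAs) ω)) = matLog (hxF (EBs ∘ₗ EAs) ω) :=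
        hAB.E_cfc hABf (hAB.F_pd hω).1 Real.log
      have f2 : EA (matLog (hxF (EBs ∘ₗ EAs) ω)) = matLog (hxF (EBs ∘ₗ EAs) ω) := by
        rw [← f1, LinearMap.comp_apply, hA.proj]
      unfold relEnt hxPhi
      rw [mul_sub, trace_sub, Complex.sub_re, trace_mul_comm (hxF EAs ω) (matLog (hxF (EBs ∘ₗ EAs) ω)),
        trace_mul_comm (hxF (EBs ∘ₗ EAs) ω), hAB.tr_F ω _ f1, hA.tr_F ω _ f2]
    rw [e1, e2] at hd
    linarith
  have ssa : hxPhi (hxF EAs ρ) + hxPhi (hxF EBs ρ) ≤ hxPhi ρ + hxPhi (hxF (EBs ∘ₗ EAs) ρ) := by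
    have l1 := ((hxPhi_lim (hA.F_psd hρ)).add (hxPhi_lim (hB.F_psd hρ))).mono_left
      (nhdsWithin_le_nhds (s := Set.Ioi 0))
    have l2 := ((hxPhi_lim hρ).add (hxPhi_lim (hAB.F_psd hρ))).mono_left
      (nhdsWithin_le_nhds (s := Set.Ioi 0))
    refine le_of_tendsto_of_tendsto l1 l2 ?_
    filter_upwards [self_mem_nhdsWithin] with ε hε
    have hε' : (0 : ℂ) < (ε : ℂ) := by exact_mod_cast hε
    have := ssa_pd (ρ + (ε : ℂ) • 1) (PosDef.posSemidef_add hρ (PosDef.one.smul hε'))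
    rwa [hxF_add hA, hxF_add hB, hxF_add hAB] at this
  have hlog : matLog ((EBs ∘ₗ EAs) 1) = matLog (EAs 1) + matLog (EBs 1) := by
    rw [← sub_eq_zero]
    apply hx_joint hA.T_pd.1 hB.T_pd.1 hTc
    intro t s R h1 h2
    by_cases hR0 : R = 0
    · simp [hR0]
    have ht : t ≠ 0 := by
      rintro rfl
      apply hR0
      apply hA.T_cancel
      rw [h1]; simp
    have hs : s ≠ 0 := by
      rintro rfl
      apply hR0
      apply hB.T_cancel
      rw [h2]; simp
    have h3 : (EBs ∘ₗ EAs) 1 * R = ((t * s : ℝ) : ℂ) • R := by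
      rw [hT, mul_assoc, h2, mul_smul_comm, h1, smul_smul]
      push_cast
      rw [mul_comm]
    unfold matLog
    rw [sub_mul, add_mul, hx_cfc_mul hA.T_pd.1 h1, hx_cfc_mul hB.T_pd.1 h2,
      hx_cfc_mul hAB.T_pd.1 h3, Real.log_mul ht hs, Complex.ofReal_add, add_smul, sub_self]
  have r := hAB.relEnt_eq hρ
  rw [LinearMap.comp_apply] at r
  rw [r, hA.relEnt_eq hρ, hB.relEnt_eq hρ, hlog, mul_add, trace_add, Complex.add_re]
  linarith

end square

/-- On a tripartite system `H_{A∂} ⊗ H_{B∂} ⊗ H_R`, let `E_A` act only on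
the first factor and `E_B` only on the second (disjoint supports, `A∂ ∩ B∂ = ∅`), both being
conditional expectations compatible with a common full-rank state `σ`. Then
`E_A ∘ E_B = E_B ∘ E_A` (commuting square, with `E_{A∪B} := E_A ∘ E_B`) and for every
density matrix `ρ`: `D(ρ‖E_{A∪B*}(ρ)) ≤ D(ρ‖E_{A*}(ρ)) + D(ρ‖E_{B*}(ρ))`. -/
theorem disjoint_support_commuting_square
    {a b c : ℕ}
    (EA EB EAs EBs :
      Matrix ((Fin a × Fin b) × Fin c) ((Fin a × Fin b) × Fin c) ℂ
        →ₗ[ℂ] Matrix ((Fin a × Fin b) × Fin c) ((Fin a × Fin b) × Fin c) ℂ)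
    (tA : Matrix (Fin a) (Fin a) ℂ → Matrix (Fin a) (Fin a) ℂ)
    (tB : Matrix (Fin b) (Fin b) ℂ → Matrix (Fin b) (Fin b) ℂ)
    -- `E_A = Ẽ_A ⊗ id` acts only on the factor `A∂`; `E_B = id ⊗ Ẽ_B ⊗ id` only on `B∂`:
    (hEAform : ∀ (M1 : Matrix (Fin a) (Fin a) ℂ) (M2 : Matrix (Fin b) (Fin b) ℂ)
      (M3 : Matrix (Fin c) (Fin c) ℂ), EA ((M1 ⊗ₖ M2) ⊗ₖ M3) = ((tA M1) ⊗ₖ M2) ⊗ₖ M3)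
    (hEBform : ∀ (M1 : Matrix (Fin a) (Fin a) ℂ) (M2 : Matrix (Fin b) (Fin b) ℂ)
      (M3 : Matrix (Fin c) (Fin c) ℂ), EB ((M1 ⊗ₖ M2) ⊗ₖ M3) = (M1 ⊗ₖ (tB M2)) ⊗ₖ M3)
    -- conditional expectation properties:
    (hEAproj : ∀ X, EA (EA X) = EA X) (hEBproj : ∀ X, EB (EB X) = EB X)
    (hEAunital : EA 1 = 1) (hEBunital : EB 1 = 1)
    (hEApos : ∀ X, X.PosSemidef → (EA X).PosSemidef)
    (hEBpos : ∀ X, X.PosSemidef → (EB X).PosSemidef)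
    (hEAbimod : ∀ X Y Z, EA Y = Y → EA Z = Z → EA (Y * X * Z) = Y * EA X * Z)
    (hEBbimod : ∀ X Y Z, EB Y = Y → EB Z = Z → EB (Y * X * Z) = Y * EB X * Z)
    -- compatibility with a common full-rank state `σ`:
    (σ : Matrix ((Fin a × Fin b) × Fin c) ((Fin a × Fin b) × Fin c) ℂ)
    (hσ : σ.PosDef) (hσtr : σ.trace = 1)
    (hEAσ : ∀ X, (σ * EA X).trace = (σ * X).trace)
    (hEBσ : ∀ X, (σ * EB X).trace = (σ * X).trace)
    -- Hilbert–Schmidt adjoints: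
    (hEAs : ∀ X Y, (EAs X * Y).trace = (X * EA Y).trace)
    (hEBs : ∀ X Y, (EBs X * Y).trace = (X * EB Y).trace) :
    (∀ X, EA (EB X) = EB (EA X)) ∧
      ∀ ρ : Matrix ((Fin a × Fin b) × Fin c) ((Fin a × Fin b) × Fin c) ℂ,
        ρ.PosSemidef → ρ.trace = 1 →
          relEnt ρ (EBs (EAs ρ)) ≤ relEnt ρ (EAs ρ) + relEnt ρ (EBs ρ) := by
  have hA : HxCE EA EAs σ := ⟨hEAproj, hEAunital, hEApos, hEAbimod, hσ, hEAσ, hEAs⟩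
  have hB : HxCE EB EBs σ := ⟨hEBproj, hEBunital, hEBpos, hEBbimod, hσ, hEBσ, hEBs⟩
  have hsingle : ∀ i j : (Fin a × Fin b) × Fin c, (Matrix.single i j (1 : ℂ))
      = (Matrix.single i.1.1 j.1.1 (1 : ℂ) ⊗ₖ Matrix.single i.1.2 j.1.2 (1 : ℂ)) ⊗ₖ
        Matrix.single i.2 j.2 (1 : ℂ) := by
    intro i j
    rw [single_kronecker_single, single_kronecker_single]
    simp
  have hc : ∀ X, EA (EB X) = EB (EA X) := by
    have : EA ∘ₗ EB = EB ∘ₗ EA := by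
      apply Matrix.ext_linearMap
      intro i j
      ext1
      change EA (EB (Matrix.single i j 1)) = EB (EA (Matrix.single i j 1))
      rw [hsingle, hEBform, hEAform, hEAform, hEBform]
    intro X
    exact LinearMap.congr_fun this X
  have hent : ∀ (T : Matrix ((Fin a × Fin b) × Fin c) ((Fin a × Fin b) × Fin c) ℂ) i j,
      T i j = (T * Matrix.single j i 1).trace := by
    intro T i j
    rw [trace_mul_single]
    simp
  have htrs : ∀ {m : ℕ} (i j : Fin m), (Matrix.single j i (1 : ℂ)).trace
      = if i = j then 1 else 0 := by
    intro m i j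
    by_cases h : i = j
    · subst h; simp
    · rw [if_neg h, trace_single_eq_of_ne _ _ _ (Ne.symm h)]
  have tA : ∃ X : Matrix (Fin a) (Fin a) ℂ, EAs 1 = (X ⊗ₖ 1) ⊗ₖ 1 := by
    refine ⟨Matrix.of fun i j => (tA (Matrix.single j i 1)).trace, ?_⟩
    ext ⟨⟨i1, i2⟩, i3⟩ ⟨⟨j1, j2⟩, j3⟩
    rw [hent (EAs 1), hA.trT, hsingle, hEAform, trace_kronecker, trace_kronecker]
    simp only [kroneckerMap_apply, one_apply, of_apply, htrs]
  have tB : ∃ X : Matrix (Fin b) (Fin b) ℂ, EBs 1 = (1 ⊗ₖ X) ⊗ₖ 1 := by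
    refine ⟨Matrix.of fun i j => (tB (Matrix.single j i 1)).trace, ?_⟩
    ext ⟨⟨i1, i2⟩, i3⟩ ⟨⟨j1, j2⟩, j3⟩
    rw [hent (EBs 1), hB.trT, hsingle, hEBform, trace_kronecker, trace_kronecker]
    simp only [kroneckerMap_apply, one_apply, of_apply, htrs]
  have h1 : (1 : Matrix ((Fin a × Fin b) × Fin c) ((Fin a × Fin b) × Fin c) ℂ)
      = (1 ⊗ₖ 1) ⊗ₖ 1 := by rw [one_kronecker_one, one_kronecker_one]
  have fA : EA (EBs 1) = EBs 1 := by
    obtain ⟨X, hX⟩ := tB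
    have u := hEAunital
    rw [h1, hEAform] at u
    rw [hX, hEAform]
    have := congrArg (· * (((1 : Matrix (Fin a) (Fin a) ℂ) ⊗ₖ X) ⊗ₖ
      (1 : Matrix (Fin c) (Fin c) ℂ))) u
    simpa only [← mul_kronecker_mul, one_mul, mul_one] using this
  have fB : EB (EAs 1) = EAs 1 := by
    obtain ⟨X, hX⟩ := tA
    have u := hEBunital
    rw [h1, hEBform] at u
    rw [hX, hEBform]
    have := congrArg (· * ((X ⊗ₖ (1 : Matrix (Fin b) (Fin b) ℂ)) ⊗ₖ
      (1 : Matrix (Fin c) (Fin c) ℂ))) u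
    simpa only [← mul_kronecker_mul, one_mul, mul_one] using this
  exact ⟨hc, fun ρ hρ _ => hx_square hA hB hc fA fB hρ⟩

end
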